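/- Let α ∈ (0,1), let γ be a real with 0 < γ < 1−α, and let f : (0,1] → ℝ be Lipschitz on every compact subinterval of (0,1], satisfy f(t) = O(t^{−γ}) as t → 0⁺, and f(1) = 0. Then lim_{N→∞} N^α Σ_{l=0}^{N} φ̂_α(N − l) · X_{N,l} exists and equals (2^α/Γ(−α)) ∫₀^1 (1−t)^{−α−1} f(t) dt, i.e. the derivative D_α(f)(1) exists and equals this value. -/

import Mathlib

open MeasureTheory Filter Asymptotics

/-- The `n`-th Fourier coefficient of `φ_α(θ) = (1-e^{iθ})^α (1+e^{-iθ})^α`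
(principal branch complex powers). -/
noncomputable def phiHat (α : ℝ) (n : ℤ) : ℂ :=
  (1 / (2 * (Real.pi : ℂ))) * ∫ θ in (-Real.pi)..Real.pi,
    (1 - Complex.exp ((θ : ℂ) * Complex.I)) ^ (α : ℂ) *
      (1 + Complex.exp (-(θ : ℂ) * Complex.I)) ^ (α : ℂ) *
      Complex.exp (-(n : ℂ) * (θ : ℂ) * Complex.I)

/-- The discretization vector `X_{N,l}`: `f(l/N)` for `0 < l < N`, and `0` at the endpoints. -/
noncomputable def Xvec (f : ℝ → ℝ) (N l : ℕ) : ℝ :=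
  if l = 0 ∨ l = N then 0 else f ((l : ℝ) / (N : ℝ))

theorem neg_one_pow_mul_choose_eq_prod (α : ℝ) (k : ℕ) :
    (-1) ^ k * Ring.choose α k = (∏ j ∈ Finset.range k, (-α + j)) / (k.factorial : ℝ) := by
  have h : ∏ j ∈ Finset.range k, (-α + j) = (-1) ^ k * ∏ j ∈ Finset.range k, (α - j) := by
    rw [← Finset.card_range k, ← Finset.prod_const, Finset.card_range, ← Finset.prod_mul_distrib]
    exact Finset.prod_congr rfl fun j _ => by ring
  rw [h, Ring.choose_eq_smul, ← descPochhammer_eval_eq_prod_range, smul_eq_mul,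
    ← Polynomial.aeval_eq_smeval, Polynomial.aeval_def, ← Polynomial.eval_map, descPochhammer_map]
  ring

theorem tendsto_rpow_mul_choose {α : ℝ} (hα : α ∈ Set.Ioo (0 : ℝ) 1) :
    Tendsto (fun k : ℕ => (k : ℝ) ^ (α + 1) * ((-1) ^ k * Ring.choose α k)) atTop
      (nhds (Real.Gamma (-α))⁻¹) := by
  obtain ⟨h0, h1⟩ := hα
  have hΓ : Real.Gamma (-α) ≠ 0 := by
    apply Real.Gamma_ne_zero
    intro m hm
    have hm' : α = m := by linarith
    rw [hm'] at h0 h1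
    have h0' : 0 < m := by exact_mod_cast h0
    have h1' : m < 1 := by exact_mod_cast h1
    omega
  rw [← tendsto_add_atTop_iff_nat 1]
  have hratio : Tendsto (fun n : ℕ => (1 + 1 / (n : ℝ)) ^ α) atTop (nhds 1) := by
    have h : Tendsto (fun n : ℕ => 1 + 1 / (n : ℝ)) atTop (nhds (1 + 0)) :=
      tendsto_const_nhds.add tendsto_one_div_atTop_nhds_zero_nat
    simpa using h.rpow_const (p := α) (Or.inr h0.le)
  have hlim := hratio.mul ((Real.GammaSeq_tendsto_Gamma (-α)).inv₀ hΓ)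
  rw [one_mul] at hlim
  refine hlim.congr' ?_
  filter_upwards [eventually_gt_atTop 0] with n hn
  have hn' : (0 : ℝ) < n := by exact_mod_cast hn
  rw [neg_one_pow_mul_choose_eq_prod, Real.GammaSeq, inv_div, Nat.factorial_succ,
    show 1 + 1 / (n : ℝ) = (n + 1) / n by field_simp, Real.div_rpow (by positivity) hn'.le,
    Real.rpow_neg hn'.le]
  push_cast
  rw [Real.rpow_add (by positivity : (0 : ℝ) < n + 1), Real.rpow_one]
  have : (n : ℝ) ^ α ≠ 0 := by positivity
  field_simp

theorem exists_abs_choose_le {α : ℝ} (hα : α ∈ Set.Ioo (0 : ℝ) 1) :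
    ∃ C : ℝ, 0 ≤ C ∧ ∀ k : ℕ, (k : ℝ) ^ (α + 1) * |Ring.choose α k| ≤ C := by
  obtain ⟨C, hC⟩ := (tendsto_rpow_mul_choose hα).abs.bddAbove_range
  refine ⟨C, (abs_nonneg _).trans (hC ⟨0, rfl⟩), fun k => ?_⟩
  have := hC ⟨k, rfl⟩
  simpa [abs_mul, abs_of_nonneg (Real.rpow_nonneg k.cast_nonneg (α + 1))] using this

theorem summable_abs_choose {α : ℝ} (hα : α ∈ Set.Ioo (0 : ℝ) 1) :
    Summable fun k : ℕ => |Ring.choose α k| := by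
  obtain ⟨C, -, hC⟩ := exists_abs_choose_le hα
  have hs : Summable fun k : ℕ => C * (1 / (k : ℝ) ^ (α + 1)) :=
    (Real.summable_one_div_nat_rpow.2 (by linarith [hα.1])).mul_left C
  rw [← summable_nat_add_iff 1] at hs ⊢
  refine hs.of_nonneg_of_le (fun _ => abs_nonneg _) fun k => ?_
  rw [mul_one_div, le_div_iff₀ (by positivity), mul_comm]
  exact hC (k + 1)

theorem hasSum_choose_mul_pow {α : ℝ} (hα : α ∈ Set.Ioo (0 : ℝ) 1) {z : ℂ} (hz : ‖z‖ ≤ 1) :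
    HasSum (fun k : ℕ => ((Ring.choose α k : ℝ) : ℂ) * z ^ k) ((1 + z) ^ (α : ℂ)) := by
  have hbound : ∀ (k : ℕ) (w : ℂ), w ∈ Metric.closedBall (0 : ℂ) 1 →
      ‖((Ring.choose α k : ℝ) : ℂ) * w ^ k‖ ≤ |Ring.choose α k| := by
    intro k w hw
    rw [norm_mul, norm_pow, Complex.norm_real, Real.norm_eq_abs]
    exact mul_le_of_le_one_right (abs_nonneg _)
      (pow_le_one₀ (norm_nonneg _) (by simpa using hw))
  have hz' : z ∈ Metric.closedBall (0 : ℂ) 1 := by simpa using hz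
  have heq : Set.EqOn (fun w : ℂ => ∑' k : ℕ, ((Ring.choose α k : ℝ) : ℂ) * w ^ k)
      (fun w => (1 + w) ^ (α : ℂ)) (Metric.closedBall 0 1) := by
    refine Set.EqOn.of_subset_closure (s := Metric.ball (0 : ℂ) 1) ?_ ?_ ?_
      Metric.ball_subset_closedBall (by rw [closure_ball _ one_ne_zero])
    · intro w hw
      have := (Complex.one_add_cpow_hasFPowerSeriesOnBall_zero (a := (α : ℂ))).hasSum
        (y := w) (by rw [← ENNReal.ofReal_one, Metric.eball_ofReal]; exact hw)
      simp only [binomialSeries_apply, zero_add, List.ofFn_const, List.prod_replicate,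
        ← Complex.ofReal_choose, smul_eq_mul] at this
      exact this.tsum_eq
    · exact continuousOn_tsum (fun k => by fun_prop) (summable_abs_choose hα) hbound
    · intro w hw
      have hre : -1 ≤ w.re :=
        (abs_le.1 ((Complex.abs_re_le_norm w).trans (by simpa using hw))).1
      exact ((Complex.continuousAt_cpow_const_of_re_pos (z := 1 + w)
        (Or.inl (by simp; linarith)) (by simpa using hα.1)).comp
          (f := fun w : ℂ => 1 + w) (by fun_prop)).continuousWithinAt
  have hsum : Summable fun k : ℕ => ((Ring.choose α k : ℝ) : ℂ) * z ^ k :=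
    Summable.of_norm_bounded (summable_abs_choose hα) fun k => hbound k z hz'
  exact hsum.hasSum_iff.2 (heq hz')

theorem integral_exp_int_mul_I (n : ℤ) :
    ∫ θ in (-Real.pi)..Real.pi, Complex.exp ((n : ℂ) * θ * Complex.I) =
      if n = 0 then 2 * (Real.pi : ℂ) else 0 := by
  split_ifs with h
  · simp only [h, Int.cast_zero, zero_mul, Complex.exp_zero, intervalIntegral.integral_const,
      Complex.real_smul]
    push_cast
    ring
  · have hc : (n : ℂ) * Complex.I ≠ 0 := mul_ne_zero (by exact_mod_cast h) Complex.I_ne_zero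
    simp only [mul_right_comm (n : ℂ) _ Complex.I]
    rw [integral_exp_mul_complex hc, div_eq_zero_iff, sub_eq_zero]
    left
    rw [Complex.exp_eq_exp_iff_exists_int]
    refine ⟨n, ?_⟩
    push_cast
    ring

theorem hasSum_integral_power_series_mul {c : ℕ → ℝ} (hc : Summable fun k => |c k|)
    {w g G : ℝ → ℂ} (hw : Continuous w) (hw1 : ∀ θ, ‖w θ‖ ≤ 1) (hg : Continuous g) (a b : ℝ)
    (hG : ∀ θ, HasSum (fun k => (c k : ℂ) * w θ ^ k) (G θ)) :
    HasSum (fun k => (c k : ℂ) * ∫ θ in a..b, w θ ^ k * g θ) (∫ θ in a..b, G θ * g θ) := by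
  simp only [← intervalIntegral.integral_const_mul, ← mul_assoc]
  refine intervalIntegral.hasSum_integral_of_dominated_convergence
    (fun k θ => |c k| * ‖g θ‖) (fun k => by fun_prop) ?_ ?_ ?_ ?_
  · refine fun k => ae_of_all _ fun θ _ => ?_
    rw [norm_mul, norm_mul, norm_pow, Complex.norm_real, Real.norm_eq_abs]
    exact mul_le_mul_of_nonneg_right (mul_le_of_le_one_right (abs_nonneg _)
      (pow_le_one₀ (norm_nonneg _) (hw1 θ))) (norm_nonneg _)
  · exact ae_of_all _ fun θ _ => hc.mul_right _
  · simp only [tsum_mul_right]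
    exact (continuous_const.mul hg.norm).intervalIntegrable _ _
  · exact ae_of_all _ fun θ _ => (hG θ).mul_right _

theorem continuous_one_sub_exp_cpow {α : ℝ} (hα : 0 < α) :
    Continuous fun θ : ℝ => (1 - Complex.exp ((θ : ℂ) * Complex.I)) ^ (α : ℂ) := by
  rw [continuous_iff_continuousAt]
  intro θ
  refine (Complex.continuousAt_cpow_const_of_re_pos (Or.inl ?_) (by simpa using hα)).comp
    (f := fun θ : ℝ => 1 - Complex.exp ((θ : ℂ) * Complex.I)) (by fun_prop)
  simpa [Complex.exp_ofReal_mul_I_re] using Real.cos_le_one θ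

theorem integral_one_sub_exp_cpow_mul {α : ℝ} (hα : α ∈ Set.Ioo (0 : ℝ) 1) (m : ℕ) :
    ∫ θ in (-Real.pi)..Real.pi, (1 - Complex.exp ((θ : ℂ) * Complex.I)) ^ (α : ℂ) *
      Complex.exp (-(m : ℂ) * (θ : ℂ) * Complex.I) =
      2 * (Real.pi : ℂ) * (((-1) ^ m * Ring.choose α m : ℝ) : ℂ) := by
  have h := hasSum_integral_power_series_mul (summable_abs_choose hα)
    (w := fun θ => -Complex.exp ((θ : ℂ) * Complex.I))
    (g := fun θ => Complex.exp (-(m : ℂ) * (θ : ℂ) * Complex.I))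
    (by fun_prop) (fun θ => by rw [norm_neg, Complex.norm_exp_ofReal_mul_I]) (by fun_prop)
    (-Real.pi) Real.pi
    (fun θ => hasSum_choose_mul_pow hα (by rw [norm_neg, Complex.norm_exp_ofReal_mul_I]))
  simp only [← sub_eq_add_neg] at h
  refine h.unique ?_
  convert hasSum_ite_eq m (2 * (Real.pi : ℂ) * (((-1) ^ m * Ring.choose α m : ℝ) : ℂ)) using 2
    with k
  have hint : ∀ θ : ℝ, (-Complex.exp ((θ : ℂ) * Complex.I)) ^ k *
      Complex.exp (-(m : ℂ) * (θ : ℂ) * Complex.I) =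
      (-1) ^ k * Complex.exp ((((k : ℤ) - m : ℤ) : ℂ) * θ * Complex.I) := by
    intro θ
    rw [neg_pow, ← Complex.exp_nat_mul, mul_assoc, ← Complex.exp_add]
    congr 2
    push_cast
    ring
  simp only [hint, intervalIntegral.integral_const_mul, integral_exp_int_mul_I, sub_eq_zero,
    Nat.cast_inj]
  split_ifs with hk
  · subst hk
    push_cast
    ring
  · simp

theorem hasSum_phiHat {α : ℝ} (hα : α ∈ Set.Ioo (0 : ℝ) 1) (n : ℕ) :
    HasSum (fun j : ℕ => ((Ring.choose α j * ((-1) ^ (n + j) * Ring.choose α (n + j)) : ℝ) : ℂ))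
      (phiHat α n) := by
  have hnorm : ∀ θ : ℝ, ‖Complex.exp (-(θ : ℂ) * Complex.I)‖ = 1 := fun θ => by
    rw [← Complex.ofReal_neg, Complex.norm_exp_ofReal_mul_I]
  have h := hasSum_integral_power_series_mul (summable_abs_choose hα)
    (w := fun θ => Complex.exp (-(θ : ℂ) * Complex.I))
    (g := fun θ => (1 - Complex.exp ((θ : ℂ) * Complex.I)) ^ (α : ℂ) *
      Complex.exp (-(n : ℂ) * (θ : ℂ) * Complex.I))
    (by fun_prop) (fun θ => (hnorm θ).le)
    ((continuous_one_sub_exp_cpow hα.1).mul (by fun_prop)) (-Real.pi) Real.pi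
    (fun θ => hasSum_choose_mul_pow hα (hnorm θ).le)
  have hpi : (Real.pi : ℂ) ≠ 0 := by exact_mod_cast Real.pi_ne_zero
  have hphi : phiHat α n = 1 / (2 * (Real.pi : ℂ)) * ∫ θ in (-Real.pi)..Real.pi,
      (1 + Complex.exp (-(θ : ℂ) * Complex.I)) ^ (α : ℂ) *
        ((1 - Complex.exp ((θ : ℂ) * Complex.I)) ^ (α : ℂ) *
          Complex.exp (-(n : ℂ) * (θ : ℂ) * Complex.I)) := by
    rw [phiHat]
    congr 2
    ext θ
    rw [Int.cast_natCast]
    ring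
  rw [hphi]
  refine (congrArg (HasSum · _) (funext fun j => ?_)).mpr (h.mul_left (1 / (2 * (Real.pi : ℂ))))
  have hint : ∀ θ : ℝ, Complex.exp (-(θ : ℂ) * Complex.I) ^ j *
      ((1 - Complex.exp ((θ : ℂ) * Complex.I)) ^ (α : ℂ) *
        Complex.exp (-(n : ℂ) * (θ : ℂ) * Complex.I)) =
      (1 - Complex.exp ((θ : ℂ) * Complex.I)) ^ (α : ℂ) *
        Complex.exp (-((n + j : ℕ) : ℂ) * (θ : ℂ) * Complex.I) := by
    intro θ
    rw [mul_left_comm, ← Complex.exp_nat_mul, ← Complex.exp_add]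
    congr 2
    push_cast
    ring
  simp only [hint, integral_one_sub_exp_cpow_mul hα]
  push_cast
  field_simp

/-- The real value of the Fourier coefficient `phiHat α n` for a natural number `n`. -/
noncomputable def phiCoeff (α : ℝ) (n : ℕ) : ℝ :=
  ∑' j : ℕ, Ring.choose α j * ((-1) ^ (n + j) * Ring.choose α (n + j))

theorem phiHat_natCast {α : ℝ} (hα : α ∈ Set.Ioo (0 : ℝ) 1) (n : ℕ) :
    phiHat α n = (phiCoeff α n : ℂ) := by
  rw [phiCoeff, Complex.ofReal_tsum, (hasSum_phiHat hα n).tsum_eq]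

theorem tsum_choose {α : ℝ} (hα : α ∈ Set.Ioo (0 : ℝ) 1) :
    ∑' j : ℕ, Ring.choose α j = (2 : ℝ) ^ α := by
  have h := (hasSum_choose_mul_pow hα (z := 1) (by simp)).tsum_eq
  simp only [one_pow, mul_one] at h
  have h2 : (1 + 1 : ℂ) ^ (α : ℂ) = (((2 : ℝ) ^ α : ℝ) : ℂ) := by
    rw [Complex.ofReal_cpow (by norm_num)]
    norm_num
  rw [h2] at h
  exact_mod_cast h

theorem tendsto_rpow_mul_phiCoeff {α : ℝ} (hα : α ∈ Set.Ioo (0 : ℝ) 1) :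
    Tendsto (fun n : ℕ => (n : ℝ) ^ (α + 1) * phiCoeff α n) atTop
      (nhds ((2 : ℝ) ^ α / Real.Gamma (-α))) := by
  obtain ⟨C, hC0, hC⟩ := exists_abs_choose_le hα
  have hα1 : 0 ≤ α + 1 := by linarith [hα.1]
  rw [div_eq_mul_inv, ← tsum_choose hα, ← tsum_mul_right]
  simp only [phiCoeff, ← tsum_mul_left]
  refine tendsto_tsum_of_dominated_convergence (bound := fun j => |Ring.choose α j| * C)
    ((summable_abs_choose hα).mul_right C) (fun j => ?_) (Eventually.of_forall fun n j => ?_)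
  · have hratio : Tendsto (fun n : ℕ => ((n : ℝ) / ((n : ℝ) + j)) ^ (α + 1)) atTop (nhds 1) := by
      simpa using (tendsto_natCast_div_add_atTop (j : ℝ)).rpow_const (p := α + 1) (Or.inr hα1)
    have hlim := (hratio.mul ((tendsto_add_atTop_iff_nat j).2
      (tendsto_rpow_mul_choose hα))).const_mul (Ring.choose α j)
    rw [one_mul] at hlim
    refine hlim.congr' ?_
    filter_upwards [eventually_gt_atTop 0] with n hn
    have hn' : (0 : ℝ) < n := by exact_mod_cast hn
    rw [Real.div_rpow (by positivity) (by positivity), Nat.cast_add]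
    have : ((n : ℝ) + j) ^ (α + 1) ≠ 0 := by positivity
    field_simp
  · rw [Real.norm_eq_abs, mul_left_comm, abs_mul]
    refine mul_le_mul_of_nonneg_left ?_ (abs_nonneg _)
    rw [abs_mul, abs_mul, abs_pow, abs_neg, abs_one, one_pow, one_mul,
      abs_of_nonneg (Real.rpow_nonneg n.cast_nonneg _)]
    refine le_trans (mul_le_mul_of_nonneg_right ?_ (abs_nonneg _)) (hC (n + j))
    exact Real.rpow_le_rpow n.cast_nonneg (by simp) hα1

theorem integral_comp_natCeil_mul (F : ℕ → ℝ) {N : ℕ} (hN : 0 < N) :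
    ∫ s in (0 : ℝ)..1, F ⌈N * s⌉₊ = 1 / N * ∑ k ∈ Finset.range N, F (k + 1) := by
  have hN' : (0 : ℝ) < N := by exact_mod_cast hN
  have hle : ∀ k : ℕ, (k : ℝ) / N ≤ ((k + 1 : ℕ) : ℝ) / N := fun k => by
    gcongr
    simp
  have hceil : ∀ (k : ℕ) (s : ℝ), s ∈ Set.uIoc ((k : ℝ) / N) (((k + 1 : ℕ) : ℝ) / N) →
      F ⌈N * s⌉₊ = F (k + 1) := by
    intro k s hs
    rw [Set.uIoc_of_le (hle k), Set.mem_Ioc, div_lt_iff₀ hN', le_div_iff₀ hN', mul_comm s] at hs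
    rw [(Nat.ceil_eq_iff k.succ_ne_zero).2 ⟨by simpa using hs.1, hs.2⟩]
  have hint : ∀ k < N, IntervalIntegrable (fun s : ℝ => F ⌈N * s⌉₊) volume
      ((k : ℝ) / N) (((k + 1 : ℕ) : ℝ) / N) := fun k _ =>
    (intervalIntegrable_const (c := F (k + 1))).congr fun s hs => (hceil k s hs).symm
  have hsum := intervalIntegral.sum_integral_adjacent_intervals (a := fun k : ℕ => (k : ℝ) / N) hint
  simp only [Nat.cast_zero, zero_div, div_self hN'.ne'] at hsum
  rw [← hsum, Finset.mul_sum]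
  refine Finset.sum_congr rfl fun k _ => ?_
  rw [intervalIntegral.integral_congr_ae (g := fun _ => F (k + 1))
    (ae_of_all _ fun s hs => hceil k s hs), intervalIntegral.integral_const, smul_eq_mul]
  push_cast
  ring

theorem exists_abs_le_rpow_mul_one_sub {γ : ℝ} (hγ0 : 0 < γ) {f : ℝ → ℝ}
    (hlip : ∀ a : ℝ, 0 < a → a ≤ 1 →
      ∃ K : ℝ, ∀ z ∈ Set.Icc a (1 : ℝ), ∀ z' ∈ Set.Icc a (1 : ℝ), |f z - f z'| ≤ K * |z - z'|)
    (hO : f =O[nhdsWithin 0 (Set.Ioi 0)] fun t : ℝ => t ^ (-γ)) (h1 : f 1 = 0) :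
    ∃ M : ℝ, 0 ≤ M ∧ ∀ t ∈ Set.Ioc (0 : ℝ) 1, |f t| ≤ M * (t ^ (-γ) * (1 - t)) := by
  obtain ⟨B, hB0, hB⟩ := hO.exists_pos
  obtain ⟨u, hu, hsub⟩ := mem_nhdsGT_iff_exists_Ioo_subset.1 hB.bound
  have hu : 0 < u := hu
  set a := min u (1 / 2)
  have ha0 : 0 < a := lt_min hu (by norm_num)
  have ha2 : a ≤ 1 / 2 := min_le_right _ _
  obtain ⟨K, hK⟩ := hlip a ha0 (by linarith)
  refine ⟨max (2 * B) |K|, le_max_of_le_right (abs_nonneg _), fun t ht => ?_⟩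
  have hpos : 0 < t ^ (-γ) := Real.rpow_pos_of_pos ht.1 _
  rcases lt_or_ge t a with hta | hta
  · have hft : |f t| ≤ B * t ^ (-γ) := by
      have := hsub ⟨ht.1, hta.trans_le (min_le_left _ _)⟩
      simpa [abs_of_pos hpos] using this
    calc |f t| ≤ B * t ^ (-γ) := hft
      _ ≤ 2 * B * (t ^ (-γ) * (1 - t)) := by
        nlinarith [mul_pos hB0 hpos]
      _ ≤ _ := mul_le_mul_of_nonneg_right (le_max_left _ _)
        (mul_nonneg hpos.le (by linarith [ht.2]))
  · have h1t : 0 ≤ 1 - t := by linarith [ht.2]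
    have hft : |f t| ≤ K * (1 - t) := by
      have := hK t ⟨hta, ht.2⟩ 1 ⟨by linarith, le_rfl⟩
      rwa [h1, sub_zero, abs_sub_comm t, abs_of_nonneg h1t] at this
    have hone : 1 ≤ t ^ (-γ) := Real.one_le_rpow_of_pos_of_le_one_of_nonpos ht.1 ht.2 (by linarith)
    calc |f t| ≤ K * (1 - t) := hft
      _ ≤ |K| * (t ^ (-γ) * (1 - t)) := mul_le_mul (le_abs_self K)
        (le_mul_of_one_le_left h1t hone) h1t (abs_nonneg _)
      _ ≤ _ := mul_le_mul_of_nonneg_right (le_max_right _ _) (mul_nonneg hpos.le h1t)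

theorem continuousAt_of_lipschitz_on_Icc {f : ℝ → ℝ}
    (hlip : ∀ a : ℝ, 0 < a → a ≤ 1 →
      ∃ K : ℝ, ∀ z ∈ Set.Icc a (1 : ℝ), ∀ z' ∈ Set.Icc a (1 : ℝ), |f z - f z'| ≤ K * |z - z'|)
    {t : ℝ} (ht : t ∈ Set.Ioo (0 : ℝ) 1) : ContinuousAt f t := by
  obtain ⟨K, hK⟩ := hlip (t / 2) (by linarith [ht.1]) (by linarith [ht.1, ht.2])
  have hcont : ContinuousOn f (Set.Icc (t / 2) 1) := by
    refine (LipschitzOnWith.of_dist_le' (K := K) fun x hx y hy => ?_).continuousOn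
    simpa [Real.dist_eq] using hK x hx y hy
  exact hcont.continuousAt (Icc_mem_nhds (by linarith [ht.1]) ht.2)

theorem intervalIntegrable_rpow_mul_one_sub_rpow {α γ : ℝ} (hα : α < 1) (hγ : γ < 1) :
    IntervalIntegrable (fun s : ℝ => s ^ (-α) * (1 - s) ^ (-γ)) volume 0 1 := by
  have h := Complex.betaIntegral_convergent (u := ((1 - α : ℝ) : ℂ)) (v := ((1 - γ : ℝ) : ℂ))
    (by rw [Complex.ofReal_re]; linarith) (by rw [Complex.ofReal_re]; linarith)
  refine h.norm.congr fun s hs => ?_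
  rw [Set.uIoc_of_le zero_le_one] at hs
  have e1 : ((1 - α : ℝ) : ℂ) - 1 = ((-α : ℝ) : ℂ) := by push_cast; ring
  have e2 : ((1 - γ : ℝ) : ℂ) - 1 = ((-γ : ℝ) : ℂ) := by push_cast; ring
  have h1s : 0 ≤ 1 - s := by linarith [hs.2]
  rw [e1, e2, ← Complex.ofReal_one, ← Complex.ofReal_sub, ← Complex.ofReal_cpow hs.1.le,
    ← Complex.ofReal_cpow h1s, ← Complex.ofReal_mul, Complex.norm_real, Real.norm_eq_abs,
    abs_of_nonneg (mul_nonneg (Real.rpow_nonneg hs.1.le _) (Real.rpow_nonneg h1s _))]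

theorem tendsto_natCeil_mul_div (s : ℝ) (hs : 0 < s) :
    Tendsto (fun N : ℕ => (⌈N * s⌉₊ : ℝ) / N) atTop (nhds s) := by
  have := (tendsto_nat_ceil_mul_div_atTop hs.le).comp tendsto_natCast_atTop_atTop (α := ℕ)
  simpa [Function.comp_def, mul_comm] using this

theorem tendsto_rpow_mul_sum_Xvec {α γ c : ℝ} (hα : α ∈ Set.Ioo (0 : ℝ) 1) (hγ0 : 0 < γ)
    (hγ : γ < 1) {f : ℝ → ℝ}
    (hlip : ∀ a : ℝ, 0 < a → a ≤ 1 →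
      ∃ K : ℝ, ∀ z ∈ Set.Icc a (1 : ℝ), ∀ z' ∈ Set.Icc a (1 : ℝ), |f z - f z'| ≤ K * |z - z'|)
    (hO : f =O[nhdsWithin 0 (Set.Ioi 0)] fun t : ℝ => t ^ (-γ)) (h1 : f 1 = 0) {q : ℕ → ℝ}
    (hq : Tendsto (fun n : ℕ => (n : ℝ) ^ (α + 1) * q n) atTop (nhds c)) :
    Tendsto (fun N : ℕ => (N : ℝ) ^ α * ∑ l ∈ Finset.range (N + 1), q (N - l) * Xvec f N l) atTop
      (nhds (c * ∫ t in (0 : ℝ)..1, (1 - t) ^ (-α - 1) * f t)) := by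
  obtain ⟨M, hM0, hM⟩ := exists_abs_le_rpow_mul_one_sub hγ0 hlip hO h1
  obtain ⟨C, hC⟩ := hq.abs.bddAbove_range
  have hC : ∀ n : ℕ, (n : ℝ) ^ (α + 1) * |q n| ≤ C := fun n => by
    have := hC ⟨n, rfl⟩
    simpa [abs_mul, abs_of_nonneg (Real.rpow_nonneg n.cast_nonneg (α + 1))] using this
  have hC0 : 0 ≤ C :=
    (mul_nonneg (Real.rpow_nonneg (Nat.cast_nonneg 0) _) (abs_nonneg _)).trans (hC 0)
  have hcond : ∀ (N : ℕ) (s : ℝ), 0 < N → 0 < s → ⌈N * s⌉₊ < N →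
      0 < ⌈N * s⌉₊ ∧ s ≤ (⌈N * s⌉₊ : ℝ) / N ∧ (1 - s) / 2 ≤ 1 - (⌈N * s⌉₊ : ℝ) / N := by
    intro N s hN hs hlt
    have hN' : (0 : ℝ) < N := by exact_mod_cast hN
    have h1 : (N * s : ℝ) ≤ ⌈N * s⌉₊ := Nat.le_ceil _
    have h2 : (⌈N * s⌉₊ : ℝ) < N * s + 1 := Nat.ceil_lt_add_one (by positivity)
    have h3 : (⌈N * s⌉₊ : ℝ) + 1 ≤ N := by exact_mod_cast hlt
    refine ⟨Nat.ceil_pos.2 (by positivity), (le_div_iff₀ hN').2 (by linarith), ?_⟩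
    rw [le_sub_iff_add_le, ← le_sub_iff_add_le', div_le_iff₀ hN']
    nlinarith
  have hXvec : ∀ N m : ℕ, 0 < m → m < N → Xvec f N (N - m) = f (1 - (m : ℝ) / N) := by
    intro N m hm hmN
    have hN' : (N : ℝ) ≠ 0 := by exact_mod_cast (by omega : N ≠ 0)
    rw [Xvec, if_neg (by omega), Nat.cast_sub hmN.le, sub_div, div_self hN']
  have hsplit : ∀ N m : ℕ, 0 < m → m < N →
      (N : ℝ) ^ (α + 1) * (q m * Xvec f N (N - m)) =
        (m : ℝ) ^ (α + 1) * q m * (((m : ℝ) / N) ^ (-α - 1) * f (1 - (m : ℝ) / N)) := by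
    intro N m hm hmN
    have hN' : (0 : ℝ) < N := by exact_mod_cast (by omega : 0 < N)
    have hm' : (0 : ℝ) < m := by exact_mod_cast hm
    rw [hXvec N m hm hmN, show -α - 1 = -(α + 1) by ring, Real.rpow_neg (by positivity),
      Real.div_rpow hm'.le hN'.le]
    have h1 := (Real.rpow_pos_of_pos hm' (α + 1)).ne'
    have h2 := (Real.rpow_pos_of_pos hN' (α + 1)).ne'
    field_simp
  have hlim : Tendsto (fun N : ℕ => ∫ s in (0 : ℝ)..1,
      (N : ℝ) ^ (α + 1) * (q ⌈N * s⌉₊ * Xvec f N (N - ⌈N * s⌉₊))) atTop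
      (nhds (∫ s in (0 : ℝ)..1, c * (s ^ (-α - 1) * f (1 - s)))) := by
    refine intervalIntegral.tendsto_integral_filter_of_dominated_convergence
      (fun s => C * M * 2 ^ γ * (s ^ (-α) * (1 - s) ^ (-γ))) ?_ ?_ ?_ ?_
    · refine Eventually.of_forall fun N => Measurable.aestronglyMeasurable ?_
      exact (measurable_from_nat (f := fun m : ℕ =>
        (N : ℝ) ^ (α + 1) * (q m * Xvec f N (N - m)))).comp
          (Nat.measurable_ceil.comp (measurable_const_mul _))
    · filter_upwards [eventually_gt_atTop 0] with N hN
      refine ae_of_all _ fun s hs => ?_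
      rw [Set.uIoc_of_le zero_le_one] at hs
      have hnn : 0 ≤ C * M * 2 ^ γ * (s ^ (-α) * (1 - s) ^ (-γ)) :=
        mul_nonneg (by positivity) (mul_nonneg (Real.rpow_nonneg hs.1.le _)
          (Real.rpow_nonneg (by linarith [hs.2]) _))
      have hN' : (0 : ℝ) < N := by exact_mod_cast hN
      rcases le_or_gt N ⌈N * s⌉₊ with hle | hlt
      · rw [Nat.sub_eq_zero_of_le hle]
        simpa [Xvec] using hnn
      · obtain ⟨hpos, hsm, h1s⟩ := hcond N s hN hs.1 hlt
        rw [hsplit N _ hpos hlt]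
        generalize ⌈N * s⌉₊ = m at *
        have hs1 : s < 1 := hsm.trans_lt ((div_lt_one hN').2 (by exact_mod_cast hlt))
        have hx0 : 0 < (m : ℝ) / N := hs.1.trans_le hsm
        generalize (m : ℝ) / N = x at *
        have hx1 : 0 < 1 - x := by linarith
        have hf := hM (1 - x) ⟨hx1, by linarith⟩
        rw [sub_sub_cancel] at hf
        have hxα : x ^ (-α - 1) * x = x ^ (-α) := by
          rw [← Real.rpow_add_one hx0.ne']
          ring_nf
        have hx2 : (1 - x) ^ (-γ) ≤ 2 ^ γ * (1 - s) ^ (-γ) := by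
          refine (Real.rpow_le_rpow_of_nonpos (by linarith) h1s (by linarith)).trans_eq ?_
          rw [Real.div_rpow (by linarith) zero_le_two, Real.rpow_neg zero_le_two]
          field_simp
        have hx3 : x ^ (-α) ≤ s ^ (-α) :=
          Real.rpow_le_rpow_of_nonpos hs.1 hsm (by linarith [hα.1])
        have hxp : 0 < x ^ (-α - 1) := Real.rpow_pos_of_pos hx0 _
        rw [Real.norm_eq_abs, abs_mul, abs_mul, abs_mul, abs_of_pos hxp,
          abs_of_nonneg (Real.rpow_nonneg m.cast_nonneg _)]
        calc (m : ℝ) ^ (α + 1) * |q m| * (x ^ (-α - 1) * |f (1 - x)|)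
            ≤ C * (x ^ (-α - 1) * (M * ((1 - x) ^ (-γ) * x))) :=
              mul_le_mul (hC m) (mul_le_mul_of_nonneg_left hf hxp.le) (by positivity) hC0
          _ = C * M * (x ^ (-α) * (1 - x) ^ (-γ)) := by rw [← hxα]; ring
          _ ≤ C * M * (s ^ (-α) * (2 ^ γ * (1 - s) ^ (-γ))) := by
              refine mul_le_mul_of_nonneg_left ?_ (by positivity)
              exact mul_le_mul hx3 hx2 (by positivity) (Real.rpow_nonneg hs.1.le _)
          _ = C * M * 2 ^ γ * (s ^ (-α) * (1 - s) ^ (-γ)) := by ring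
    · exact (intervalIntegrable_rpow_mul_one_sub_rpow hα.2 hγ).const_mul _
    · have hne : ∀ᵐ s : ℝ, s ≠ 1 := by
        simp [ae_iff, measure_singleton]
      filter_upwards [hne] with s hs1 hs
      rw [Set.uIoc_of_le zero_le_one] at hs
      have hs1 : s < 1 := lt_of_le_of_ne hs.2 hs1
      have hx := tendsto_natCeil_mul_div s hs.1
      have hceil : Tendsto (fun N : ℕ => ⌈N * s⌉₊) atTop atTop :=
        tendsto_nat_ceil_atTop.comp
          (tendsto_natCast_atTop_atTop.atTop_mul_const hs.1)
      have hcont : ContinuousAt (fun x : ℝ => x ^ (-α - 1) * f (1 - x)) s := by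
        refine (Real.continuousAt_rpow_const _ _ (Or.inl hs.1.ne')).mul ?_
        exact (continuousAt_of_lipschitz_on_Icc hlip ⟨by linarith, by linarith [hs.1]⟩).comp
          (f := fun x : ℝ => 1 - x) (by fun_prop)
      refine ((hq.comp hceil).mul (hcont.tendsto.comp hx)).congr' ?_
      filter_upwards [eventually_gt_atTop 0, hx.eventually_lt_const hs1] with N hN hlt
      have hN' : (0 : ℝ) < N := by exact_mod_cast hN
      exact (hsplit N _ (Nat.ceil_pos.2 (mul_pos hN' hs.1))
        (by exact_mod_cast (div_lt_one hN').1 hlt)).symm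
  have hintegral : ∫ s in (0 : ℝ)..1, c * (s ^ (-α - 1) * f (1 - s)) =
      c * ∫ t in (0 : ℝ)..1, (1 - t) ^ (-α - 1) * f t := by
    rw [intervalIntegral.integral_const_mul]
    have := intervalIntegral.integral_comp_sub_left
      (fun t : ℝ => (1 - t) ^ (-α - 1) * f t) (a := 0) (b := 1) 1
    simp only [sub_sub_cancel, sub_self, sub_zero] at this
    rw [this]
  rw [hintegral] at hlim
  refine hlim.congr' ?_
  filter_upwards [eventually_gt_atTop 0] with N hN
  have hN' : (0 : ℝ) < N := by exact_mod_cast hN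
  rw [integral_comp_natCeil_mul
    (fun m => (N : ℝ) ^ (α + 1) * (q m * Xvec f N (N - m))) hN, ← Finset.mul_sum,
    ← Finset.sum_range_reflect, Finset.sum_range_succ]
  have hX : Xvec f N N = 0 := by simp [Xvec]
  rw [hX, mul_zero, add_zero, Real.rpow_add_one hN'.ne', ← mul_assoc]
  congr 1
  · field_simp
  · refine Finset.sum_congr rfl fun k hk => ?_
    have := Finset.mem_range.1 hk
    congr 2 <;> omega

/-- For `α ∈ (0,1)`, `0 < γ < 1-α`, and `f` Lipschitz on every compact subinterval of `(0,1]`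
with `f(t) = O(t^{-γ})` as `t → 0⁺` and `f(1) = 0`, the derivative `D_α(f)(1)` exists and
equals `(2^α/Γ(-α)) ∫₀^1 (1-t)^{-α-1} f(t) dt`. -/
theorem fractional_derivative_at_one (α : ℝ) (hα : α ∈ Set.Ioo (0 : ℝ) 1)
    (γ : ℝ) (hγ0 : 0 < γ) (hγ : γ < 1 - α) (f : ℝ → ℝ)
    (hlip : ∀ a : ℝ, 0 < a → a ≤ 1 →
      ∃ K : ℝ, ∀ z ∈ Set.Icc a (1 : ℝ), ∀ z' ∈ Set.Icc a (1 : ℝ), |f z - f z'| ≤ K * |z - z'|)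
    (hO : f =O[nhdsWithin 0 (Set.Ioi 0)] fun t : ℝ => t ^ (-γ))
    (h1 : f 1 = 0) :
    Tendsto
      (fun N : ℕ => (((N : ℝ) ^ α : ℝ) : ℂ) *
        ∑ l ∈ Finset.range (N + 1), phiHat α ((N : ℤ) - (l : ℤ)) * ((Xvec f N l : ℝ) : ℂ))
      atTop
      (nhds ((((2 : ℝ) ^ α / Real.Gamma (-α) *
        ∫ t in (0 : ℝ)..1, (1 - t) ^ (-α - 1) * f t : ℝ) : ℂ))) := by
  have h := (Complex.continuous_ofReal.tendsto _).comp
    (tendsto_rpow_mul_sum_Xvec hα hγ0 (by linarith [hα.1]) hlip hO h1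
      (tendsto_rpow_mul_phiCoeff hα))
  refine h.congr fun N => ?_
  rw [Function.comp_apply, Complex.ofReal_mul, Complex.ofReal_sum]
  congr 1
  refine Finset.sum_congr rfl fun l hl => ?_
  have hle : l ≤ N := Nat.lt_succ_iff.1 (Finset.mem_range.1 hl)
  rw [← Nat.cast_sub hle, phiHat_natCast hα, Complex.ofReal_mul]
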